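/- No SAFA with initialization accepts the language L = { w ∈ ((a,d)(a,d) : d ∈ D)* } over Σ = {a} of data words that are concatenations of pairs of identical data values; that is, even if the sets of a SAFA are allowed to hold arbitrary finite initial contents before the computation begins, no such automaton accepts L. -/

import Mathlib

/-- A condition tested by a SAFA transition: membership (`pos h` = `p(h)`)
or non-membership (`neg h` = `!p(h)`) of the current data value in set `h`. -/
inductive SafaCond (H : Type) : Type
  | pos (h : H)
  | neg (h : H)

/-- The set name a condition refers to. -/
def SafaCond.name {H : Type} : SafaCond H → H
  | .pos h => h
  | .neg h => h

/-- An operation of a SAFA transition: do nothing (`−`) or insert the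
current data value into set `h` (`ins(h)`). -/
inductive SafaOp (H : Type) : Type
  | noop
  | ins (h : H)

/-- Whether a condition holds for data value `d` given set contents `s`. -/
def SafaCond.holds {H D : Type} : SafaCond H → D → (H → Set D) → Prop
  | .pos h, d, s => d ∈ s h
  | .neg h, d, s => d ∉ s h

/-- The effect of an operation on the set contents, reading data value `d`. -/
def SafaOp.apply {H D : Type} : SafaOp H → D → (H → Set D) → (H → Set D)
  | .noop, _, s => s
  | .ins h, d, s => fun j => s j ∪ {x | j = h ∧ x = d}

/-- A transition of a SAFA: source state, attribute, condition, operation, target state. -/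
structure SafaTrans (Q A H : Type) : Type where
  src : Q
  attr : A
  cond : SafaCond H
  op : SafaOp H
  dst : Q

/-- A set augmented finite automaton over attributes `A` and data values `D`:
a finite set of states `Q` with initial state `q0` and final states `F`,
a finite collection `H` of set names, and a transition relation `δ`. -/
structure SAFA (A D : Type) : Type 1 where
  Q : Type
  fintypeQ : Fintype Q
  q0 : Q
  F : Set Q
  H : Type
  fintypeH : Fintype H
  δ : Set (SafaTrans Q A H)

attribute [instance] SAFA.fintypeQ SAFA.fintypeH

namespace SAFA

variable {A D : Type}

/-- A configuration: a state together with the current contents of the sets. -/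
abbrev Config (M : SAFA A D) : Type := M.Q × (M.H → Set D)

/-- The initial configuration: initial state, all sets empty. -/
def init (M : SAFA A D) : M.Config := (M.q0, fun _ => ∅)

/-- One step: from configuration `c`, taking transition `t` while reading letter `ad`,
reaching configuration `c'`. -/
def StepVia (M : SAFA A D) (c : M.Config) (t : SafaTrans M.Q A M.H)
    (ad : A × D) (c' : M.Config) : Prop :=
  t ∈ M.δ ∧ t.src = c.1 ∧ t.attr = ad.1 ∧ t.dst = c'.1 ∧
    t.cond.holds ad.2 c.2 ∧ c'.2 = t.op.apply ad.2 c.2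

/-- Execution of a sequence of transitions `T` reading the data word `w`,
from configuration `c` to configuration `c'`. -/
inductive ExecFrom (M : SAFA A D) :
    M.Config → List (SafaTrans M.Q A M.H) → List (A × D) → M.Config → Prop
  | nil (c : M.Config) : ExecFrom M c [] [] c
  | cons {c c' c'' : M.Config} {t : SafaTrans M.Q A M.H}
      {ts : List (SafaTrans M.Q A M.H)} {ad : A × D} {w : List (A × D)} :
      M.StepVia c t ad c' → ExecFrom M c' ts w c'' → ExecFrom M c (t :: ts) (ad :: w) c''

/-- Acceptance: some run from the initial configuration consumes all of `w`
and ends in a final state. -/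
def Accepts (M : SAFA A D) (w : List (A × D)) : Prop :=
  ∃ T c, M.ExecFrom M.init T w c ∧ c.1 ∈ M.F

/-- The data language accepted by `M`. -/
def Lang (M : SAFA A D) : Set (List (A × D)) := {w | M.Accepts w}

/-- A SAFA is deterministic if, for every state and attribute, all outgoing
transitions test membership in one and the same set, with at most one transition
per polarity of the condition. -/
def IsDeterministic (M : SAFA A D) : Prop :=
  ∀ t1 t2 : SafaTrans M.Q A M.H, t1 ∈ M.δ → t2 ∈ M.δ →
    t1.src = t2.src → t1.attr = t2.attr →
    t1.cond.name = t2.cond.name ∧ (t1.cond = t2.cond → t1 = t2)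

end SAFA

/-- The language accepted by a SAFA whose sets start with the prescribed (initialized)
contents `h0` instead of being empty. -/
def SAFA.LangFrom {A D : Type} (M : SAFA A D) (h0 : M.H → Set D) :
    Set (List (A × D)) :=
  {w | ∃ T c, M.ExecFrom (M.q0, h0) T w c ∧ c.1 ∈ M.F}

/-- The operation only changes membership of the data value being read. -/
theorem SafaOp.mem_apply_of_ne {H D : Type} (o : SafaOp H) {d x : D} (s : H → Set D) (h : H)
    (hx : x ≠ d) : x ∈ o.apply d s h ↔ x ∈ s h := by
  cases o <;> simp [SafaOp.apply, hx]

theorem SafaOp.subset_apply {H D : Type} (o : SafaOp H) (d : D) (s : H → Set D) (h : H) :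
    s h ⊆ o.apply d s h := by
  cases o
  · exact subset_rfl
  · exact Set.subset_union_left

/-- Whether a value satisfies a condition depends only on the sets containing that value. -/
theorem SafaCond.holds_congr {H D : Type} (c : SafaCond H) {d : D} {s s' : H → Set D}
    (hs : ∀ h, d ∈ s h ↔ d ∈ s' h) : c.holds d s ↔ c.holds d s' := by
  cases c <;> simp [SafaCond.holds, hs]

theorem SafaOp.mem_apply_congr {H D : Type} (o : SafaOp H) {d x : D} {s s' : H → Set D}
    (hs : ∀ h, x ∈ s h ↔ x ∈ s' h) (h : H) : x ∈ o.apply d s h ↔ x ∈ o.apply d s' h := by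
  cases o <;> simp [SafaOp.apply, hs]

/-- A run can be replayed from any set contents that agree on the data values of the word. -/
theorem SAFA.ExecFrom.exists_of_agree {A D : Type} {M : SAFA A D} {c c' : M.Config}
    {T : List (SafaTrans M.Q A M.H)} {w : List (A × D)} (hrun : M.ExecFrom c T w c') :
    ∀ s : M.H → Set D, (∀ ad ∈ w, ∀ h, ad.2 ∈ c.2 h ↔ ad.2 ∈ s h) →
      ∃ s', M.ExecFrom (c.1, s) T w (c'.1, s') := by
  induction hrun with
  | nil c => exact fun s _ => ⟨s, .nil _⟩
  | @cons c c₁ c₂ t ts ad w hstep _ ih =>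
    intro s hs
    obtain ⟨hδ, hsrc, hattr, hdst, hcond, hop⟩ := hstep
    obtain ⟨s', hs'⟩ := ih (t.op.apply ad.2 s) fun x hx h => by
      rw [hop]
      exact t.op.mem_apply_congr (hs x (List.mem_cons_of_mem _ hx)) h
    exact ⟨s', .cons (c' := (c₁.1, t.op.apply ad.2 s)) ⟨hδ, hsrc, hattr, hdst,
      (t.cond.holds_congr (hs ad List.mem_cons_self)).1 hcond, rfl⟩ hs'⟩

/-- The language of concatenations of pairs of identical data values. -/
def pairStar (D : Type) : Set (List (Unit × D)) :=
  {w | ∃ ws : List (List (Unit × D)),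
    (∀ u ∈ ws, ∃ d : D, u = [((), d), ((), d)]) ∧ w = ws.flatten}

theorem cons_cons_mem_pairStar {D : Type} {d e : D} {w : List (Unit × D)} :
    ((), d) :: ((), e) :: w ∈ pairStar D ↔ d = e ∧ w ∈ pairStar D := by
  constructor
  · rintro ⟨_ | ⟨u, ws⟩, hws, hw⟩
    · simp at hw
    · obtain ⟨x, rfl⟩ := hws u List.mem_cons_self
      simp only [List.flatten_cons, List.cons_append, List.nil_append, List.cons.injEq,
        Prod.mk.injEq, true_and] at hw
      obtain ⟨rfl, rfl, rfl⟩ := hw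
      exact ⟨rfl, ws, fun u hu => hws u (List.mem_cons_of_mem _ hu), rfl⟩
  · rintro ⟨rfl, ws, hws, rfl⟩
    exact ⟨[((), d), ((), d)] :: ws, by simpa using hws, rfl⟩

/-- The word `f k, f k, f (k+1), f (k+1), …` made of `m` pairs. -/
def pairWord {D : Type} (f : ℕ → D) : ℕ → ℕ → List (Unit × D)
  | _, 0 => []
  | k, m + 1 => ((), f k) :: ((), f k) :: pairWord f (k + 1) m

theorem pairWord_mem_pairStar {D : Type} (f : ℕ → D) (k m : ℕ) :
    pairWord f k m ∈ pairStar D := by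
  induction m generalizing k with
  | zero => exact ⟨[], by simp, rfl⟩
  | succ m ih => exact cons_cons_mem_pairStar.2 ⟨rfl, ih _⟩

theorem exists_of_mem_pairWord {D : Type} {f : ℕ → D} {k m : ℕ} {x : Unit × D}
    (hx : x ∈ pairWord f k m) : ∃ j, k ≤ j ∧ j < k + m ∧ x.2 = f j := by
  induction m generalizing k with
  | zero => simp [pairWord] at hx
  | succ m ih =>
    simp only [pairWord, List.mem_cons] at hx
    rcases hx with rfl | rfl | hx
    · exact ⟨k, le_rfl, by omega, rfl⟩
    · exact ⟨k, le_rfl, by omega, rfl⟩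
    · obtain ⟨j, hkj, hjm, hj⟩ := ih hx
      exact ⟨j, by omega, by omega, hj⟩

/-- In a configuration from which only words of `pairStar` are accepted, the number of pairs of
fresh values that can be read is bounded by the number of sets that are still empty. -/
theorem SAFA.add_ncard_nonempty_le {D : Type} (M : SAFA Unit D) {f : ℕ → D}
    (hf : Function.Injective f) (m k : ℕ) (c c' : M.Config) (T : List (SafaTrans M.Q Unit M.H))
    (hL : ∀ T w c', M.ExecFrom c T w c' → c'.1 ∈ M.F → w ∈ pairStar D)
    (hfresh : ∀ j, k ≤ j → ∀ h, f j ∉ c.2 h)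
    (hrun : M.ExecFrom c T (pairWord f k m) c') (hF : c'.1 ∈ M.F) :
    m + {h | (c.2 h).Nonempty}.ncard ≤ Fintype.card M.H := by
  induction m generalizing k c T with
  | zero =>
    rw [zero_add, ← Nat.card_eq_fintype_card]
    exact Set.ncard_le_card _
  | succ m ih =>
    obtain _ | @⟨_, c₁, _, t₁, _, _, _, h₁, _ | @⟨_, c₂, _, t₂, T, _, _, h₂, hrun⟩⟩ := hrun
    have hop₁ : c₁.2 = t₁.op.apply (f k) c.2 := h₁.2.2.2.2.2
    have hop₂ : c₂.2 = t₂.op.apply (f k) c₁.2 := h₂.2.2.2.2.2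
    have hcond : t₂.cond.holds (f k) c₁.2 := h₂.2.2.2.2.1
    have hne : ∀ j, k + 1 ≤ j → f j ≠ f k := fun j hj h => by
      have := hf h
      omega
    have hsub₁ : ∀ h, c.2 h ⊆ c₁.2 h := fun h => hop₁ ▸ t₁.op.subset_apply _ _ _
    have hsub₂ : ∀ h, c₁.2 h ⊆ c₂.2 h := fun h => hop₂ ▸ t₂.op.subset_apply _ _ _
    have hfresh₁ : ∀ j, k + 1 ≤ j → ∀ h, f j ∉ c₁.2 h := fun j hj h => by
      rw [hop₁, t₁.op.mem_apply_of_ne _ _ (hne j hj)]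
      exact hfresh j (by omega) h
    have hfresh₂ : ∀ j, k + 1 ≤ j → ∀ h, f j ∉ c₂.2 h := fun j hj h => by
      rw [hop₂, t₂.op.mem_apply_of_ne _ _ (hne j hj)]
      exact hfresh₁ j hj h
    have hreplace : ∀ e, e ≠ f k → (∀ j, k + 1 ≤ j → j < k + 1 + m → f j ≠ e) →
        ¬ t₂.cond.holds e c₁.2 := by
      intro e hek hej hholds
      obtain ⟨s', hs'⟩ := hrun.exists_of_agree (t₂.op.apply e c₁.2) fun x hx h => by
        obtain ⟨j, hkj, hjm, hj⟩ := exists_of_mem_pairWord hx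
        rw [hj, hop₂, t₂.op.mem_apply_of_ne _ _ (hne j hkj),
          t₂.op.mem_apply_of_ne _ _ (hej j hkj hjm)]
      have hacc := hL _ _ _ (.cons h₁ (.cons (ad := ((), e)) (c' := (c₂.1, t₂.op.apply e c₁.2))
        ⟨h₂.1, h₂.2.1, rfl, h₂.2.2.2.1, hholds, rfl⟩ hs')) hF
      exact hek (cons_cons_mem_pairStar.1 hacc).1.symm
    have hlt : {h | (c.2 h).Nonempty}.ncard < {h | (c₂.2 h).Nonempty}.ncard := by
      refine Set.ncard_lt_ncard (Set.ssubset_iff_exists.2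
        ⟨fun h hh => hh.mono ((hsub₁ h).trans (hsub₂ h)), ?_⟩) (Set.toFinite _)
      cases hc : t₂.cond with
      | pos h =>
        rw [hc] at hcond hreplace
        refine ⟨h, ⟨f k, hsub₂ h hcond⟩, ?_⟩
        rintro ⟨e, he⟩
        refine hreplace e ?_ ?_ (hsub₁ h he)
        · rintro rfl
          exact hfresh k le_rfl h he
        · rintro j hj - rfl
          exact hfresh j (by omega) h he
      | neg h =>
        rw [hc] at hreplace
        refine absurd (hfresh₁ (k + 1 + m) (by omega) h)
          (hreplace _ (hne _ (by omega)) fun j _ hj hjm => ?_)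
        have := hf hjm
        omega
    have := ih (k + 1) c₂ T
      (fun T w c' hw hwF => (cons_cons_mem_pairStar.1
        (hL _ _ _ (.cons h₁ (.cons h₂ hw)) hwF)).2) hfresh₂ hrun
    omega

/-- no SAFA with initialization (sets holding arbitrary finite initial
contents) accepts the language of data words over {a} that are concatenations of pairs
(a,d)(a,d) of identical data values. -/
theorem safa_init_cannot_accept_pair_star {D : Type} [Countable D] [Infinite D] :
    ¬ ∃ (M : SAFA Unit D) (h0 : M.H → Set D),
        (∀ i, (h0 i).Finite) ∧
        M.LangFrom h0 =
          {w : List (Unit × D) | ∃ ws : List (List (Unit × D)),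
            (∀ u ∈ ws, ∃ d : D, u = [((), d), ((), d)]) ∧ w = ws.flatten} := by
  rintro ⟨M, h0, hfin, hL⟩
  change M.LangFrom h0 = pairStar D at hL
  have hinf : (⋃ i, h0 i)ᶜ.Infinite := (Set.finite_iUnion hfin).infinite_compl
  let f : ℕ → D := fun n => hinf.natEmbedding _ n
  have hf : Function.Injective f :=
    Subtype.val_injective.comp (hinf.natEmbedding _).injective
  have hfresh : ∀ j, 0 ≤ j → ∀ h, f j ∉ h0 h := fun j _ h hj =>
    (hinf.natEmbedding _ j).2 (Set.mem_iUnion.2 ⟨h, hj⟩)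
  obtain ⟨T, c, hrun, hF⟩ : pairWord f 0 (Fintype.card M.H + 1) ∈ M.LangFrom h0 :=
    hL ▸ pairWord_mem_pairStar f 0 _
  have := M.add_ncard_nonempty_le hf _ 0 (M.q0, h0) c T
    (fun T w c' hw hwF => hL ▸ (⟨T, c', hw, hwF⟩ : w ∈ M.LangFrom h0)) hfresh hrun hF
  omega
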